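/- Let f₀ := x¹⁰ + a₁x⁹ + a₂x⁸ + a₃x⁷ + a₄x⁶ + a₅x⁵ + a₆x⁴ + a₇x³ + a₈x² + a₉x + a₁₀, g₀ := x² − 6x + a₁₁, g₁ := x³ + a₁₂x² + a₁₃x + a₁₄, with a₁,…,a₁₄ the explicit rational functions in α given in the context, and set f(x, α, t) := f₀³·(x − 3) − t·g₀⁸·g₁⁴·x. Let s be a transcendental over ℚ. Then there exists a nonconstant rational function r ∈ ℚ(s) such that the specialized polynomial f(x, 1/2, r), of degree 31 in x over ℚ(s), factors over ℚ(s) as a product of two polynomials of degrees 15 and 16 respectively. -/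

import Mathlib

/-!
Statement 6: there is a nonconstant rational function `r ∈ ℚ(s)` such that the specialized
polynomial `f(x, 1/2, r)`, of degree 31 in `x` over `ℚ(s)`, factors over `ℚ(s)` as a product
of two polynomials of degrees 15 and 16.
We model `ℚ(s)` as `RatFunc ℚ`, with `s = RatFunc.X` a transcendental over `ℚ`; the
specialization `α = 1/2` is realized via the constant embedding `RatFunc.C : ℚ →+* RatFunc ℚ`.
-/

open Polynomial

namespace PSL52Family

/-- The coefficient `a₁` as a rational function of `α`. -/
noncomputable def a1 {F : Type*} [Field F] (α : F) : F :=
  2 * (α^4 - 37/2*α^3 - 3*α^2 - 109/2*α + 91) / ((α - 2) * (α + 1)^2)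

/-- The coefficient `a₂` as a rational function of `α`. -/
noncomputable def a2 {F : Type*} [Field F] (α : F) : F :=
  -12 * ((α^2 - 5/2*α - 8) * (α^3 + 10*α^2 + 17*α + 44)) / ((α - 2) * (α + 1) * (α + 4))

/-- The coefficient `a₃` as a rational function of `α`. -/
noncomputable def a3 {F : Type*} [Field F] (α : F) : F :=
  -8 * (α^6 - 93/2*α^5 - 261/2*α^4 - 1343/2*α^3 - 507/2*α^2 - 963*α + 3076) /
    ((α - 2) * (α + 1) * (α + 4))

/-- The coefficient `a₄` as a rational function of `α`. -/
noncomputable def a4 {F : Type*} [Field F] (α : F) : F :=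
  62 * (α^9 + 159/31*α^8 - 1410/31*α^7 - 3834/31*α^6 - 987*α^5 - 52905/31*α^4 - 72480/31*α^3
      - 50196/31*α^2 + 256224/31*α - 56384/31) / ((α - 2)^2 * (α + 1) * (α + 4)^2)

/-- The coefficient `a₅` as a rational function of `α`. -/
noncomputable def a5 {F : Type*} [Field F] (α : F) : F :=
  -36 * (α^9 + 241/6*α^8 + 226/3*α^7 + 521/3*α^6 + 1483/3*α^5 - 19319/6*α^4 - 12872/3*α^3
      - 58186/3*α^2 - 51344/3*α + 30944/3) / ((α - 2)^2 * (α + 4)^2)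

/-- The coefficient `a₆` as a rational function of `α`. -/
noncomputable def a6 {F : Type*} [Field F] (α : F) : F :=
  -92 * ((α + 1)^2 * (α^7 - 337/23*α^6 - 237/23*α^5 - 2075/23*α^4 - 7724/23*α^3 + 2166/23*α^2
      - 35740/23*α + 44048/23)) / ((α - 2)^2 * (α + 4))

/-- The coefficient `a₇` as a rational function of `α`. -/
noncomputable def a7 {F : Type*} [Field F] (α : F) : F :=
  152 * ((α + 1)^3 * (α^7 + 5/38*α^6 - 489/38*α^5 - 407/38*α^4 - 4367/38*α^3 - 3768/19*α^2
      - 2882/19*α - 23192/19)) / ((α - 2)^2 * (α + 4))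

/-- The coefficient `a₈` as a rational function of `α`. -/
noncomputable def a8 {F : Type*} [Field F] (α : F) : F :=
  -87 * ((α + 1)^4 * (α^6 + 96/29*α^5 + 66/29*α^4 + 532/29*α^3 - 3/29*α^2 + 300/29*α + 4724/29)) /
    ((α - 2)^2)

/-- The coefficient `a₉` as a rational function of `α`. -/
noncomputable def a9 {F : Type*} [Field F] (α : F) : F :=
  18 * ((α + 1)^6 * (α^5 + 53/6*α^4 + 70/3*α^3 + 111/2*α^2 + 376/3*α + 94/3)) / ((α - 2)^2)

/-- The coefficient `a₁₀` as a rational function of `α`. -/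
noncomputable def a10 {F : Type*} [Field F] (α : F) : F :=
  -6 * ((α + 1)^9 * (α + 4)) / (α - 2)

/-- The coefficient `a₁₁` as a rational function of `α`. -/
noncomputable def a11 {F : Type*} [Field F] (α : F) : F := -(α + 1)^2

/-- The coefficient `a₁₂` as a rational function of `α`. -/
noncomputable def a12 {F : Type*} [Field F] (α : F) : F :=
  (α + 1) * (α^2 - 16*α - 8) / ((α - 2) * (α + 4))

/-- The coefficient `a₁₃` as a rational function of `α`. -/
noncomputable def a13 {F : Type*} [Field F] (α : F) : F := -3*(α + 1)^2

/-- The coefficient `a₁₄` as a rational function of `α`. -/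
noncomputable def a14 {F : Type*} [Field F] (α : F) : F := (α + 1)^3 * (α + 4) / (α - 2)

/-- `f₀ = x¹⁰ + a₁x⁹ + ⋯ + a₁₀`. -/
noncomputable def f0 {F : Type*} [Field F] (α : F) : Polynomial F :=
  X^10 + C (a1 α) * X^9 + C (a2 α) * X^8 + C (a3 α) * X^7 + C (a4 α) * X^6 + C (a5 α) * X^5
    + C (a6 α) * X^4 + C (a7 α) * X^3 + C (a8 α) * X^2 + C (a9 α) * X + C (a10 α)

/-- `g₀ = x² − 6x + a₁₁`. -/
noncomputable def g0 {F : Type*} [Field F] (α : F) : Polynomial F :=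
  X^2 - 6*X + C (a11 α)

/-- `g₁ = x³ + a₁₂x² + a₁₃x + a₁₄`. -/
noncomputable def g1 {F : Type*} [Field F] (α : F) : Polynomial F :=
  X^3 + C (a12 α) * X^2 + C (a13 α) * X + C (a14 α)

/-- The family `f(x, α, t) = f₀³·(x − 3) − t·g₀⁸·g₁⁴·x`, as a polynomial in `x` over `F`,
where `α, t : F`. -/
noncomputable def fFamily {F : Type*} [Field F] (α t : F) : Polynomial F :=
  (f0 α)^3 * (X - 3) - C t * (g0 α)^8 * (g1 α)^4 * X

section ListPolynomials

/-- The value at `x` of the polynomial with the given integer coefficients, listed from the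
constant term upwards. -/
def evalList {R : Type*} [CommRing R] (x : R) : List ℤ → R
  | [] => 0
  | a :: l => a + x * evalList x l

/-- The value at `(x, y)` of the polynomial in `x` whose coefficients are the given polynomials
in `y`. -/
def evalList₂ {R : Type*} [CommRing R] (x y : R) : List (List ℤ) → R
  | [] => 0
  | a :: l => evalList y a + x * evalList₂ x y l

/-- Addition of coefficient lists. -/
def addList : List ℤ → List ℤ → List ℤ
  | [], b => b
  | a :: as, [] => a :: as
  | a :: as, b :: bs => (a + b) :: addList as bs

/-- Multiplication of a coefficient list by a scalar. -/
def smulList (c : ℤ) (l : List ℤ) : List ℤ := l.map (c * ·)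

/-- Multiplication of coefficient lists. -/
def mulList : List ℤ → List ℤ → List ℤ
  | [], _ => []
  | a :: as, b => addList (smulList a b) (0 :: mulList as b)

/-- Powers of a coefficient list. -/
def powList (l : List ℤ) : ℕ → List ℤ
  | 0 => [1]
  | n + 1 => mulList (powList l n) l

/-- Addition of bivariate coefficient lists. -/
def addList₂ : List (List ℤ) → List (List ℤ) → List (List ℤ)
  | [], b => b
  | a :: as, [] => a :: as
  | a :: as, b :: bs => addList a b :: addList₂ as bs

/-- Multiplication of bivariate coefficient lists. -/
def mulList₂ : List (List ℤ) → List (List ℤ) → List (List ℤ)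
  | [], _ => []
  | a :: as, b => addList₂ (b.map (mulList a)) ([] :: mulList₂ as b)

/-- The coefficient list of the product `a(x) * b(y)`. -/
def tensorList (a b : List ℤ) : List (List ℤ) := a.map (smulList · b)

variable {R : Type*} [CommRing R] (x y : R)

lemma evalList_addList (a b : List ℤ) :
    evalList x (addList a b) = evalList x a + evalList x b := by
  fun_induction addList a b <;> simp_all [evalList]; ring

lemma evalList_smulList (c : ℤ) (l : List ℤ) :
    evalList x (smulList c l) = c * evalList x l := by
  unfold smulList
  induction l with
  | nil => simp [evalList]
  | cons a l ih => simp only [List.map_cons, evalList, ih]; push_cast; ring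

lemma evalList_mulList (a b : List ℤ) :
    evalList x (mulList a b) = evalList x a * evalList x b := by
  induction a with
  | nil => simp [mulList, evalList]
  | cons a as ih =>
    simp only [mulList, evalList_addList, evalList_smulList, evalList, ih]; push_cast; ring

lemma evalList_powList (l : List ℤ) (n : ℕ) :
    evalList x (powList l n) = evalList x l ^ n := by
  induction n with
  | zero => simp [powList, evalList]
  | succ n ih => rw [powList, evalList_mulList, ih, pow_succ]

lemma evalList₂_addList₂ (a b : List (List ℤ)) :
    evalList₂ x y (addList₂ a b) = evalList₂ x y a + evalList₂ x y b := by
  fun_induction addList₂ a b <;> simp_all [evalList₂, evalList_addList]; ring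

lemma evalList₂_map_mulList (c : List ℤ) (l : List (List ℤ)) :
    evalList₂ x y (l.map (mulList c)) = evalList y c * evalList₂ x y l := by
  induction l with
  | nil => simp [evalList₂]
  | cons a l ih => simp only [List.map_cons, evalList₂, ih, evalList_mulList]; ring

lemma evalList₂_mulList₂ (a b : List (List ℤ)) :
    evalList₂ x y (mulList₂ a b) = evalList₂ x y a * evalList₂ x y b := by
  induction a with
  | nil => simp [mulList₂, evalList₂]
  | cons a as ih =>
    simp only [mulList₂, evalList₂_addList₂, evalList₂_map_mulList, evalList₂, evalList, ih]; ring

lemma evalList₂_tensorList (a b : List ℤ) :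
    evalList₂ x y (tensorList a b) = evalList x a * evalList y b := by
  unfold tensorList
  induction a with
  | nil => simp [evalList₂, evalList]
  | cons a as ih => simp only [List.map_cons, evalList₂, evalList, ih, evalList_smulList]; ring

lemma evalList_eq_zero {l : List ℤ} (h : ∀ a ∈ l, a = 0) : evalList x l = 0 := by
  induction l with
  | nil => rfl
  | cons a l ih => simp_all [evalList]

lemma evalList₂_eq_zero {l : List (List ℤ)} (h : ∀ r ∈ l, ∀ a ∈ r, a = 0) :
    evalList₂ x y l = 0 := by
  induction l with
  | nil => rfl
  | cons r l ih =>
    rw [evalList₂, evalList_eq_zero y (h r (by simp)), ih fun r hr => h r (by simp [hr])]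
    simp

lemma map_evalList {S : Type*} [CommRing S] (φ : R →+* S) (l : List ℤ) :
    φ (evalList x l) = evalList (φ x) l := by
  induction l with
  | nil => simp [evalList]
  | cons a l ih => simp [evalList, ih]

lemma evalList_intCast (a : ℤ) (l : List ℤ) :
    evalList (a : R) l = (evalList a l : ℤ) := by
  simpa using (map_evalList a (Int.castRingHom R) l).symm

lemma coeff_evalList₂ (l : List (List ℤ)) (n : ℕ) :
    (evalList₂ X (C y) l).coeff n = evalList y (l.getD n []) := by
  induction l generalizing n with
  | nil => simp [evalList₂, evalList]
  | cons a l ih =>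
    rw [evalList₂, ← map_evalList]
    cases n with
    | zero => simp
    | succ n => simp [ih, coeff_X_mul]

lemma natDegree_evalList₂ {l : List (List ℤ)} {n : ℕ} (hl : l.length = n + 1)
    (hn : evalList y (l.getD n []) ≠ 0) : (evalList₂ X (C y) l).natDegree = n := by
  refine natDegree_eq_of_le_of_coeff_ne_zero ?_ (by rwa [coeff_evalList₂])
  rw [natDegree_le_iff_coeff_eq_zero]
  intro m hm
  rw [coeff_evalList₂, List.getD_eq_default _ _ (by omega)]
  rfl

/-- A polynomial with integer coefficients that does not vanish at the integer `a` does not vanish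
at the variable of `ℚ(s)`. -/
lemma evalList_ratFuncX_ne_zero (l : List ℤ) (a : ℤ) (h : evalList a l ≠ 0) :
    evalList (RatFunc.X : RatFunc ℚ) l ≠ 0 := by
  rw [← RatFunc.algebraMap_X, ← map_evalList]
  intro h0
  rw [map_eq_zero_iff _ (RatFunc.algebraMap_injective ℚ)] at h0
  have h1 := congrArg (evalRingHom (a : ℚ)) h0
  rw [map_evalList, map_zero, coe_evalRingHom, eval_X, evalList_intCast] at h1
  exact h (by exact_mod_cast h1)

end ListPolynomials

section Specialization

/-- The coefficients of `256 f₀` at `α = 1/2`. -/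
def f0Half : List ℤ :=
  [177147, 2598156, -8548983, -17659296, -5828112, 770688, 343008, 493056, -150528, -9216, 256]

/-- The coefficients of `4 g₀` at `α = 1/2`. -/
def g0Half : List ℤ := [-9, -24, 4]

/-- The coefficients of `8 g₁` at `α = 1/2`. -/
def g1Half : List ℤ := [-81, -54, 28, 8]

/-- The numerator `f₀³ (y - 3)` at `α = 0`. -/
def numZero : List ℤ :=
  mulList (powList
    [12, 141, -3543, -11596, -11012, -5802, -1762, 3076, -528, -91, 1] 3) [-3, 1]

/-- The denominator `g₀⁸ g₁⁴ y` at `α = 0`. -/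
def denZero : List ℤ :=
  mulList (mulList (powList [-1, -6, 1] 8) (powList [-2, -3, 1, 1] 4)) [0, 1]

/-- The factor of degree 15 in `x`, with coefficients in `ℤ[y]`. -/
def factor15 : List (List ℤ) :=
  [[0, -396718580736, -2380311484416, -4562263678464, -991796451840, 6322702380480,
     5058161904384, -2628260597376, -3570467226624, 123974556480, 991796451840, 148769467776,
     -99179645184, -24794911296],
   [-223154201664, -5940447498000, -13928369233644, 69320932863165, 364058516952648,
     641078888566230, 476758792828980, 51280310372391, -106931498701680, -15703960381452,
     24699691949148, 908931513915, -918444839256, -251823317850, -9814652388, 43046721],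
   [-595077871104, -3675156852096, 224111560739040, 1642483148516856, 4593779388216288,
     6189967624957740, 3674263470014304, -207961770251160, -1457616001477824, -425208660826392,
     254106668986848, 26844432644376, -11847222894240, -154987327476, -95047159968, 497428776],
   [-286518974976, 29016168416640, 798205284136224, 3769134603968520, 6333679630205712,
     3215422133972820, 310951528540560, 2806281483367464, 1393029219975840, -1510216811469288,
     -84963623943168, 118165119817320, 12872104736976, -6539944832460, 129356990928, 2181033864],
   [440798423040, 53415789645312, 906134556938112, 2218709641015008, -2796697350244800,
     -13323617142845760, -8433109853785728, 6822357538086432, 4423220282017728,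
     -2155517005458240, -41684380263360, 75501149239008, -796233722112, 567407037312,
     -128282771520, 4355454240],
   [383657886720, 27972333262080, 314559389373120, -477108971113680, -5985908482242240,
     -10073430142776000, -2372789987608320, 3203013807403920, -1063724671745280,
     -613032949347840, 715156837508160, -112978588693680, -43343206816320, 11712884057280,
     -342994383360, 3495175920],
   [-95778422784, -4266191047680, -94085175020544, -88646025818880, 1608360001049088,
     5203284951718080, 4242941117164800, -2265407132592384, -2507326215840000, 1071904962377088,
     -12821556448512, -13442339162880, -6078207257856, 263862774720, 24956854272, 214430976],
   [-143076409344, -7330598931456, -82381682396160, 448358693596416, 2649082056403968,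
     3167834140117440, -576942300205056, -1458847672335360, 1081961003367936, 355467132367488,
     -479941739177472, 105599550721536, 8555364840960, -3788918876736, 60409815552, -403294464],
   [-1863254016, -900453335040, -19497984823296, -95045009126400, -534310656657408,
     -1469422543380480, -1160566621470720, 617800977183744, 471150654289920, -365625129719808,
     116208467085312, -20320013030400, -208862613504, 709502146560, -4375959552, -48024576],
   [21107589120, 691367104512, 2142347553792, -111193764187392, -383510772264960,
     -147991621224960, 522076444111872, 194756730054912, -342850715062272, -2327323622400,
     85374387348480, -29075230132992, 2566290014208, 75884262912, -4882498560, 18558720],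
   [3238133760, 207551987712, 4246412746752, 29592801957888, 111508755701760, 169035590845440,
     -1890092924928, -147475543062528, 34013385105408, 61112782264320, -44419398451200,
     12996538103808, -1553469898752, 19393938432, 343941120, 1935360],
   [-987365376, -32284016640, -193630887936, 3131365017600, 988187922432, -31480510510080,
     -30632695787520, 32397533743104, 13000466718720, -21323212167168, 8031743557632,
     -1455530342400, 171235086336, -9082967040, 261623808, -423936],
   [-297271296, -8284667904, -120396349440, -794768941056, -1629706764288, 515725148160,
     2561654685696, -2379051786240, -2115819749376, 2746767163392, -764689563648, -12129509376,
     20462960640, -836173824, 15187968, -24576],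
   [-21233664, -557383680, -6427951104, -83740078080, -8659320832, 522903879680, 451432448000,
     -162577158144, -43376640000, -64097452032, 38581813248, 897822720, -2031108096, 66027520,
     -1015808, 4096],
   [0, -16515072, -99090432, 3288727552, -5808455680, -35126231040, -27924037632, 2714370048,
     7103250432, -136151040, -868024320, 57802752, 58130432, -1359872],
   [0, 262144, 6815744, 68550656, 328335360, 729825280, 588120064, 89718784, -79560704,
     -18513920, 5898240, 720896, -262144, 16384]]

/-- The factor of degree 16 in `x`, with coefficients in `ℤ[y]`. -/
def factor16 : List (List ℤ) :=
  [[43046721, 2066242608, 43046721000, 506229438960, 3646057268700, 16184878348464,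
     41262520507992, 45302369180400, -17601373749690, -45302369180400, 41262520507992,
     -16184878348464, 3646057268700, -506229438960, 43046721000, -2066242608, 43046721],
   [918330048, 27626428944, 740881898100, 20751963259680, 212594362705800, 67759977449232,
     266228300378556, 922592629972800, -370479595439520, -208317431826000, 297660824733996,
     -232952630221152, 106110167265000, -24721827529680, 2476143051300, -44079842304, 535692528],
   [8418025440, -123974556480, -8308686768660, 50867874424080, 2414122589883960,
     4732994669215680, -518393262515580, -1811053865615760, 3657180158768880, 1029790316842560,
     -1416997453538700, -684107800978320, 849366416207160, -265951613062080, 31698829440540,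
     -765402585840, 2550916800],
   [42855402240, -1254881004480, -124473855928320, -1669915130048640, -723876277387680,
     10369056552076800, 16388299167946560, 7529321191740480, -18291547319040, -2658448543596480,
     -744451736100480, -608797948769280, 1599246486724320, -668196632223360, 93499622671680,
     -1651236788160, 5423060160],
   [129756634560, 14901719014080, 203318341911360, -522010562921280, -1712062395160560,
     11566127842326720, 42211037557428480, 38326075774608960, -9250559057746080,
     -17547746973716160, 4623621793545600, 1776470218931520, 463127056010640, -663877694934720,
     126448007290560, -315879082560, 3348734400],
   [227292355584, 5736269912832, 302291579085120, 3188411268065280, 8990444543834880,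
     17438231610902016, 40308283183485888, 48240072808369920, 406279173358080,
     -24460449647454720, 1831630488827328, 4974836791198464, -1189151645368320,
     -239318330561280, 93001291801920, 1718366980608, -5130107136],
   [187717243392, -3505792679424, -124213114906560, 1607701281408000, 9036308487317760,
     17576545878344448, 21843354152758464, 22467981131216640, 6620691173184000,
     -13131200079843840, -5186716719621696, 4107838356882432, -719653699319040, 32440126752000,
     25340066360640, 915980638464, -6750563328],
   [-15721205760, 3959958481920, -22718686325760, -861090174213120, -1835848759357440,
     574928311726080, 1087838527057920, -3779089090191360, -2803401905080320, -1761636406947840,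
     -3074127684710400, 660799587962880, 412971989621760, 38109376005120, -21631327810560,
     -726538429440, 2046643200],
   [-109527759360, -1371478625280, 59841388500480, -459429255383040, -3331754680884480,
     -7433277925939200, -9614835959523840, -9711282233502720, -5212436713597440,
     1358928970398720, 1285575085278720, -501751278766080, 316739335115520, -6891285288960,
     -18046801451520, -507091829760, 4311221760],
   [6987202560, -447414865920, -33855068759040, 80262255697920, 404479977891840,
     -384818197524480, -2326658678737920, -2861616612925440, -1414012158074880, 847233240330240,
     1248687185126400, -66234449018880, -82731684648960, -14899605073920, 1088931548160,
     173012336640, -909619200],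
   [37079949312, 298723147776, 2605055800320, 87268673064960, 570888814049280, 1483353950035968,
     1860352411474944, 1222723141816320, 437183093698560, 65903502458880, 72852779510784,
     40037473677312, -60704910673920, -3015065640960, 2991181317120, 133965656064, -1333444608],
   [-19954335744, -175221522432, 2001042800640, -17606048808960, -126628666122240,
     -213688712626176, 18192573775872, 407890653757440, 395458595389440, 8569196789760,
     -143692823789568, -14451968507904, 8486416834560, 1892400168960, -68095426560,
     -31908446208, 450379776],
   [5062901760, 116756398080, 532627292160, 1737134161920, -5788653096960, -53667019898880,
     -124341266923520, -108620160778240, -9860567162880, 24482185789440, -5771947622400,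
     -7727547924480, 2799707811840, 520613806080, -124896215040, -17146101760, 130662400],
   [-743178240, -36778475520, -499960135680, -1974518415360, -2270289592320, 3519820595200,
     10586149437440, 3956814315520, -9639271464960, -7435211243520, 1226765844480,
     1088281313280, 152584519680, -108125552640, -17107271680, 5033820160, -94044160],
   [64880640, 4755947520, 85644656640, 460503777280, 1376974274560, 2893391790080,
     3985702993920, 2388116439040, -879343697920, -1371386019840, 171177164800, 307863879680,
     -61865328640, -14015201280, 2916925440, 146472960, 19660800],
   [-3145728, -170655744, -3042181120, -12518686720, -16539975680, 5440012288, 30486298624,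
     16952852480, -19380305920, -23454023680, 9512157184, 12406751232, -6401556480, -522977280,
     706478080, -94109696, -1835008],
   [65536, 1835008, 20316160, 110100480, 279511040, 161480704, -551682048, -651427840,
     588513280, 651427840, -551682048, -161480704, 279511040, -110100480, 20316160, -1835008,
     65536]]

set_option maxRecDepth 100000 in
lemma factor15_mul_factor16_coeff :
    ∀ r ∈ addList₂ (mulList₂ factor15 factor16)
      (addList₂ (tensorList (mulList (powList f0Half 3) [-3, 1]) (smulList (-64) denZero))
        (tensorList (mulList (mulList (powList g0Half 8) (powList g1Half 4)) [0, 1])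
          (smulList (-1) numZero))), ∀ a ∈ r, a = 0 := by
  decide +kernel

lemma factor15_mul_factor16 {R : Type*} [CommRing R] (x y : R) :
    evalList₂ x y factor15 * evalList₂ x y factor16 =
      64 * (evalList x f0Half ^ 3 * (x - 3)) * evalList y denZero +
        evalList x g0Half ^ 8 * evalList x g1Half ^ 4 * x * evalList y numZero := by
  have h := evalList₂_eq_zero x y factor15_mul_factor16_coeff
  simp only [evalList₂_addList₂, evalList₂_mulList₂, evalList₂_tensorList, evalList_mulList,
    evalList_powList, evalList_smulList] at h
  have h3 : evalList x [-3, 1] = x - 3 := by simp [evalList]; ring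
  have h1 : evalList x [0, 1] = x := by simp [evalList]
  rw [h3, h1] at h
  push_cast at h
  linear_combination h

variable {F : Type*} [Field F]

lemma ofNat_mul_C {d : ℕ} [d.AtLeastTwo] {c : F} {n : ℤ} (h : OfNat.ofNat d * c = n) :
    (OfNat.ofNat d : F[X]) * C c = n := by
  rw [← C_ofNat, ← C_mul, h, map_intCast]

variable [CharZero F]

lemma f0_half : 256 * f0 (1 / 2 : F) = evalList X f0Half := by
  have h1 := ofNat_mul_C (d := 256) (c := a1 (1 / 2 : F)) (n := -9216)
    (by norm_num [a1])
  have h2 := ofNat_mul_C (d := 256) (c := a2 (1 / 2 : F)) (n := -150528)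
    (by norm_num [a2])
  have h3 := ofNat_mul_C (d := 256) (c := a3 (1 / 2 : F)) (n := 493056)
    (by norm_num [a3])
  have h4 := ofNat_mul_C (d := 256) (c := a4 (1 / 2 : F)) (n := 343008)
    (by norm_num [a4])
  have h5 := ofNat_mul_C (d := 256) (c := a5 (1 / 2 : F)) (n := 770688)
    (by norm_num [a5])
  have h6 := ofNat_mul_C (d := 256) (c := a6 (1 / 2 : F)) (n := -5828112)
    (by norm_num [a6])
  have h7 := ofNat_mul_C (d := 256) (c := a7 (1 / 2 : F)) (n := -17659296)
    (by norm_num [a7])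
  have h8 := ofNat_mul_C (d := 256) (c := a8 (1 / 2 : F)) (n := -8548983)
    (by norm_num [a8])
  have h9 := ofNat_mul_C (d := 256) (c := a9 (1 / 2 : F)) (n := 2598156)
    (by norm_num [a9])
  have h10 := ofNat_mul_C (d := 256) (c := a10 (1 / 2 : F)) (n := 177147)
    (by norm_num [a10])
  simp only [f0, f0Half, evalList]
  push_cast at *
  linear_combination X ^ 9 * h1 + X ^ 8 * h2 + X ^ 7 * h3 + X ^ 6 * h4 + X ^ 5 * h5 + X ^ 4 * h6 +
    X ^ 3 * h7 + X ^ 2 * h8 + X * h9 + h10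

lemma g0_half : 4 * g0 (1 / 2 : F) = evalList X g0Half := by
  have h := ofNat_mul_C (d := 4) (c := a11 (1 / 2 : F)) (n := -9) (by norm_num [a11])
  simp only [g0, g0Half, evalList]
  push_cast at *
  linear_combination h

lemma g1_half : 8 * g1 (1 / 2 : F) = evalList X g1Half := by
  have h12 := ofNat_mul_C (d := 8) (c := a12 (1 / 2 : F)) (n := 28)
    (by norm_num [a12])
  have h13 := ofNat_mul_C (d := 8) (c := a13 (1 / 2 : F)) (n := -54)
    (by norm_num [a13])
  have h14 := ofNat_mul_C (d := 8) (c := a14 (1 / 2 : F)) (n := -81)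
    (by norm_num [a14])
  simp only [g1, g1Half, evalList]
  push_cast at *
  linear_combination X ^ 2 * h12 + X * h13 + h14

/-- If `4 t · denZero(y) = -numZero(y)`, then `f(x, 1/2, t)` is, up to a constant, the product of
the specializations at `y` of the two explicit factors. -/
lemma fFamily_half_eq {t y : F} (ht : 4 * t * evalList y denZero = -evalList y numZero) :
    C (2 ^ 30 * evalList y denZero) * fFamily (1 / 2) t =
      evalList₂ X (C y) factor15 * evalList₂ X (C y) factor16 := by
  have ht' := congrArg C ht
  simp only [map_mul, map_neg, map_evalList, map_ofNat] at ht'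
  rw [factor15_mul_factor16, ← f0_half, ← g0_half, ← g1_half, fFamily]
  simp only [map_mul, map_pow, map_evalList, map_ofNat]
  linear_combination (-2 ^ 28 * g0 (1 / 2) ^ 8 * g1 (1 / 2) ^ 4 * X) * ht'

end Specialization

/-- There exists a nonconstant rational function `r ∈ ℚ(s)` such that the
polynomial `f(x, 1/2, r)` of degree 31 in `x` factors over `ℚ(s)` as a product of two
polynomials of degrees 15 and 16. -/
theorem fFamily_at_half_factors :
    ∃ r : RatFunc ℚ, (∀ c : ℚ, r ≠ RatFunc.C c) ∧
      ∃ p q : Polynomial (RatFunc ℚ),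
        fFamily (RatFunc.C (1/2 : ℚ)) r = p * q ∧
        p.natDegree = 15 ∧ q.natDegree = 16 := by
  set s : RatFunc ℚ := RatFunc.X with hs
  have hD : evalList s denZero ≠ 0 := evalList_ratFuncX_ne_zero _ 1 (by decide +kernel)
  have h15 : evalList s (factor15.getD 15 []) ≠ 0 :=
    evalList_ratFuncX_ne_zero _ 1 (by decide +kernel)
  have h16 : evalList s (factor16.getD 16 []) ≠ 0 :=
    evalList_ratFuncX_ne_zero _ 2 (by decide +kernel)
  have hc : 2 ^ 30 * evalList s denZero ≠ 0 := mul_ne_zero (by norm_num) hD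
  have hr : 4 * (-evalList s numZero / (4 * evalList s denZero)) * evalList s denZero =
      -evalList s numZero := by
    field_simp
  refine ⟨-evalList s numZero / (4 * evalList s denZero), ?_,
    C (2 ^ 30 * evalList s denZero)⁻¹ * evalList₂ X (C s) factor15,
    evalList₂ X (C s) factor16, ?_, ?_, ?_⟩
  · intro c hrc
    rw [hrc, hs, ← RatFunc.algebraMap_X, ← map_evalList, ← map_evalList, ← RatFunc.algebraMap_C,
      ← map_ofNat (algebraMap ℚ[X] (RatFunc ℚ)) 4, ← map_mul, ← map_mul, ← map_neg] at hr
    have h0 := congrArg (evalRingHom ((0 : ℤ) : ℚ)) (RatFunc.algebraMap_injective ℚ hr)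
    simp only [map_mul, map_neg, map_evalList, coe_evalRingHom, eval_X, evalList_intCast] at h0
    have hden : evalList (0 : ℤ) denZero = 0 := by decide +kernel
    have hnum : evalList (0 : ℤ) numZero ≠ 0 := by decide +kernel
    rw [hden] at h0
    exact hnum (by simpa using h0)
  · have h := fFamily_half_eq hr
    rw [mul_assoc, ← h, ← mul_assoc, ← C_mul, inv_mul_cancel₀ hc, C_1, one_mul]
    congr 1
    simp
  · rw [natDegree_C_mul (inv_ne_zero hc)]
    exact natDegree_evalList₂ s rfl h15
  · exact natDegree_evalList₂ s rfl h16

end PSL52Family
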